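/- Let $H \in (0,1/2)$, $\kappa > 0$ and $\varepsilon > 0$. Then $\frac{4\,\Gamma(2H)\,\sin(H\pi)\, H\,(\tfrac12 - H)}{(1-2H)\,\pi} \int_0^{\infty} \int_{\mathbb{R}} e^{-\kappa s \xi^2}\,(1-\cos(\xi\varepsilon))\, |\xi|^{1-2H}\, d\xi\, ds = \kappa^{-1}\, \varepsilon^{2H}$. -/

import Mathlib

open MeasureTheory Real

/-- Tonelli's theorem on the positive quadrant for a nonnegative function whose first iterated
Bochner integral is nonzero, hence genuinely convergent. -/
theorem integral_Ioi_swap_of_nonneg {f : ℝ → ℝ → ℝ} {g : ℝ → ℝ} {A : ℝ}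
    (hm : Measurable (Function.uncurry f))
    (hf : ∀ x, 0 < x → ∀ y, 0 < y → 0 ≤ f x y)
    (hi : ∀ y, 0 < y → IntegrableOn (fun x => f x y) (Set.Ioi 0))
    (hg : ∀ y, 0 < y → ∫ x in Set.Ioi (0:ℝ), f x y = g y)
    (hA : ∫ y in Set.Ioi (0:ℝ), g y = A) (hA0 : A ≠ 0) :
    ∫ x in Set.Ioi (0:ℝ), ∫ y in Set.Ioi (0:ℝ), f x y = A := by
  have hgi : IntegrableOn g (Set.Ioi 0) := by
    by_contra h
    exact hA0 (hA.symm.trans (integral_undef h))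
  rw [integral_integral_swap, setIntegral_congr_fun measurableSet_Ioi hg, hA]
  rw [integrable_prod_iff' hm.aestronglyMeasurable]
  refine ⟨(ae_restrict_mem measurableSet_Ioi).mono hi, ?_⟩
  refine hgi.congr_fun (fun y hy => ?_) measurableSet_Ioi
  rw [← hg y hy]
  refine setIntegral_congr_fun measurableSet_Ioi fun x hx => ?_
  exact (Real.norm_of_nonneg (hf x hx y hy)).symm

theorem integral_one_sub_cos_mul_exp_neg_mul_Ioi {t : ℝ} (ht : 0 < t) :
    ∫ x in Set.Ioi (0:ℝ), (1 - cos x) * exp (-t * x) = 1 / (t * (1 + t ^ 2)) := by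
  have hre : (-(t:ℂ) + Complex.I).re < 0 := by simpa using ht
  have hc := integrableOn_exp_mul_complex_Ioi hre 0
  have hpt : ∀ x : ℝ, RCLike.re (Complex.exp ((-(t:ℂ) + Complex.I) * x)) =
      cos x * exp (-t * x) := by
    intro x
    simp [Complex.exp_re, mul_comm]
  have hcos : IntegrableOn (fun x => cos x * exp (-t * x)) (Set.Ioi 0) :=
    hc.re.congr (Filter.Eventually.of_forall hpt)
  have h2 := integral_re hc
  simp only [hpt] at h2
  rw [integral_exp_mul_complex_Ioi hre] at h2
  simp only [sub_mul, one_mul]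
  rw [integral_sub (exp_neg_integrableOn_Ioi 0 ht) hcos, h2,
    integral_exp_mul_Ioi (neg_neg_of_pos ht)]
  simp [Complex.div_re, Complex.normSq_apply]
  field_simp
  ring

theorem integral_rpow_div_one_add_sq_Ioi {H : ℝ} (h0 : 0 < H) (h1 : H < 1) :
    ∫ t in Set.Ioi (0:ℝ), t ^ (2 * H - 1) / (1 + t ^ 2) = π / (2 * sin (π * H)) := by
  have hs : 0 < sin (π * H) :=
    sin_pos_of_pos_of_lt_pi (by positivity) (by nlinarith [pi_pos])
  have hG := Gamma_pos_of_pos h0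
  have hinner : ∀ u : ℝ, 0 < u →
      ∫ t in Set.Ioi (0:ℝ), t ^ (2 * H - 1) * exp (-u * (1 + t ^ 2)) =
        u ^ ((1 - H) - 1) * exp (-(1 * u)) * (Gamma H / 2) := by
    intro u hu
    have h := integral_rpow_mul_exp_neg_mul_rpow (p := 2) (q := 2 * H - 1) (b := u)
      two_pos (by linarith) hu
    simp only [rpow_two] at h
    have he : ∀ t : ℝ, t ^ (2 * H - 1) * exp (-u * (1 + t ^ 2)) =
        exp (-(1 * u)) * (t ^ (2 * H - 1) * exp (-u * t ^ 2)) := by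
      intro t
      rw [show -u * (1 + t ^ 2) = -(1 * u) + -u * t ^ 2 by ring, exp_add]
      ring
    simp only [he]
    rw [integral_const_mul, h, show -(2 * H - 1 + 1) / 2 = (1 - H) - 1 by ring,
      show (2 * H - 1 + 1) / 2 = H by ring]
    ring
  have houter : ∫ u in Set.Ioi (0:ℝ), u ^ ((1 - H) - 1) * exp (-(1 * u)) * (Gamma H / 2) =
      π / (2 * sin (π * H)) := by
    rw [integral_mul_const, integral_rpow_mul_exp_neg_mul_Ioi (by linarith) one_pos]
    have := Real.Gamma_mul_Gamma_one_sub H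
    rw [div_one, one_rpow, one_mul, mul_comm 2, ← div_div, ← this]
    ring
  rw [← integral_Ioi_swap_of_nonneg (f := fun t u => t ^ (2 * H - 1) * exp (-u * (1 + t ^ 2)))
    (by fun_prop) (fun t ht u _ => by positivity) ?_ hinner houter (by positivity)]
  · refine setIntegral_congr_fun measurableSet_Ioi fun t _ => ?_
    have ht2 : -(1 + t ^ 2) < 0 := by nlinarith [sq_nonneg t]
    have he : ∀ u : ℝ, -u * (1 + t ^ 2) = -(1 + t ^ 2) * u := fun u => by ring
    simp only [he]
    rw [integral_const_mul, integral_exp_mul_Ioi ht2, mul_zero, exp_zero, neg_div_neg_eq]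
    ring
  · intro u hu
    refine Integrable.of_integral_ne_zero ?_
    rw [hinner u hu]
    positivity

theorem integral_one_sub_cos_mul_rpow_Ioi {H : ℝ} (h0 : 0 < H) (h1 : H < 1) :
    ∫ x in Set.Ioi (0:ℝ), (1 - cos x) * x ^ (-1 - 2 * H) =
      π / (2 * sin (π * H) * Gamma (2 * H + 1)) := by
  have hs : 0 < sin (π * H) :=
    sin_pos_of_pos_of_lt_pi (by positivity) (by nlinarith [pi_pos])
  have hG : 0 < Gamma (2 * H + 1) := Gamma_pos_of_pos (by linarith)
  have hinner : ∀ t : ℝ, 0 < t →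
      ∫ x in Set.Ioi (0:ℝ), t ^ (2 * H) * ((1 - cos x) * exp (-t * x)) =
        t ^ (2 * H - 1) / (1 + t ^ 2) := by
    intro t ht
    rw [integral_const_mul, integral_one_sub_cos_mul_exp_neg_mul_Ioi ht, rpow_sub_one ht.ne']
    field_simp
  have key := integral_Ioi_swap_of_nonneg
    (f := fun x t => t ^ (2 * H) * ((1 - cos x) * exp (-t * x)))
    (by fun_prop)
    (fun x _ t ht => mul_nonneg (rpow_nonneg (le_of_lt ht) _)
      (mul_nonneg (sub_nonneg.2 (cos_le_one x)) (exp_pos _).le))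
    (fun t ht => Integrable.of_integral_ne_zero (by rw [hinner t ht]; positivity))
    hinner (integral_rpow_div_one_add_sq_Ioi h0 h1) (by positivity)
  have hx : ∀ x ∈ Set.Ioi (0:ℝ),
      ∫ t in Set.Ioi (0:ℝ), t ^ (2 * H) * ((1 - cos x) * exp (-t * x)) =
        (1 - cos x) * x ^ (-1 - 2 * H) * Gamma (2 * H + 1) := by
    intro x hx
    have he : ∀ t : ℝ, t ^ (2 * H) * ((1 - cos x) * exp (-t * x)) =
        (1 - cos x) * (t ^ ((2 * H + 1) - 1) * exp (-(x * t))) := by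
      intro t
      rw [add_sub_cancel_right, show -t * x = -(x * t) by ring]
      ring
    simp only [he]
    rw [integral_const_mul, integral_rpow_mul_exp_neg_mul_Ioi (by linarith) hx, one_div,
      inv_rpow (le_of_lt hx), ← rpow_neg (le_of_lt hx), show -(2 * H + 1) = -1 - 2 * H by ring]
    ring
  rw [setIntegral_congr_fun measurableSet_Ioi hx, integral_mul_const] at key
  rw [← div_div, ← key]
  field_simp

theorem integral_one_sub_cos_mul_mul_rpow_Ioi {H ε : ℝ} (h0 : 0 < H) (h1 : H < 1)
    (hε : 0 < ε) :
    ∫ x in Set.Ioi (0:ℝ), (1 - cos (x * ε)) * x ^ (-1 - 2 * H) =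
      ε ^ (2 * H) * (π / (2 * sin (π * H) * Gamma (2 * H + 1))) := by
  have h := integral_comp_mul_right_Ioi (fun x => (1 - cos x) * x ^ (-1 - 2 * H)) 0 hε
  rw [zero_mul, integral_one_sub_cos_mul_rpow_Ioi h0 h1, smul_eq_mul] at h
  have he : ∀ x ∈ Set.Ioi (0:ℝ), (1 - cos (x * ε)) * (x * ε) ^ (-1 - 2 * H) =
      (1 - cos (x * ε)) * x ^ (-1 - 2 * H) * ε ^ (-1 - 2 * H) := by
    intro x hx
    rw [mul_rpow (le_of_lt hx) hε.le]
    ring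
  rw [setIntegral_congr_fun measurableSet_Ioi he, integral_mul_const] at h
  have hp : ε ^ (-1 - 2 * H) = ε⁻¹ * (ε ^ (2 * H))⁻¹ := by
    rw [rpow_sub hε, rpow_neg_one, div_eq_mul_inv]
  have hpos : 0 < ε ^ (2 * H) := rpow_pos_of_pos hε _
  have hsc : ε⁻¹ * (ε ^ (2 * H))⁻¹ ≠ 0 := by positivity
  rw [hp] at h
  refine mul_right_cancel₀ hsc (h.trans ?_)
  field_simp

theorem spatial_increment_variance_rough (H κ ε : ℝ) (hH : H ∈ Set.Ioo (0:ℝ) (1/2))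
    (hκ : 0 < κ) (hε : 0 < ε) :
    (4 * Real.Gamma (2*H) * Real.sin (H * π) * H * (1/2 - H)) / ((1 - 2*H) * π) *
      ∫ s in Set.Ioi (0:ℝ), ∫ ξ : ℝ,
        Real.exp (-κ * s * ξ^2) * (1 - Real.cos (ξ * ε)) * |ξ| ^ (1 - 2*H) =
      κ⁻¹ * ε ^ (2*H) := by
  obtain ⟨h0, h2⟩ := hH
  have h1 : H < 1 := by linarith
  have hs : 0 < sin (π * H) :=
    sin_pos_of_pos_of_lt_pi (by positivity) (by nlinarith [pi_pos])
  have hG : 0 < Gamma (2 * H) := Gamma_pos_of_pos (by linarith)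
  have hG' : Gamma (2 * H + 1) = 2 * H * Gamma (2 * H) := Gamma_add_one (by positivity)
  have hpos : 0 < ε ^ (2 * H) := rpow_pos_of_pos hε _
  have hfold : ∀ s : ℝ,
      ∫ ξ : ℝ, exp (-κ * s * ξ ^ 2) * (1 - cos (ξ * ε)) * |ξ| ^ (1 - 2 * H) =
        2 * ∫ ξ in Set.Ioi (0:ℝ),
          exp (-κ * s * ξ ^ 2) * (1 - cos (ξ * ε)) * ξ ^ (1 - 2 * H) := by
    intro s
    rw [← integral_comp_abs
      (f := fun ξ => exp (-κ * s * ξ ^ 2) * (1 - cos (ξ * ε)) * ξ ^ (1 - 2 * H))]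
    refine integral_congr_ae (Filter.Eventually.of_forall fun ξ => ?_)
    have hc : cos (|ξ| * ε) = cos (ξ * ε) := by
      rw [← cos_abs (ξ * ε), abs_mul, abs_of_pos hε]
    simp only [sq_abs, hc]
  have hexp : ∀ s ξ : ℝ, exp (-κ * s * ξ ^ 2) * (1 - cos (ξ * ε)) * ξ ^ (1 - 2 * H) =
      exp (-(κ * ξ ^ 2) * s) * ((1 - cos (ξ * ε)) * ξ ^ (1 - 2 * H)) := by
    intro s ξ
    rw [show -κ * s * ξ ^ 2 = -(κ * ξ ^ 2) * s by ring]
    ring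
  have hinner : ∀ ξ : ℝ, 0 < ξ → ∫ s in Set.Ioi (0:ℝ),
      exp (-(κ * ξ ^ 2) * s) * ((1 - cos (ξ * ε)) * ξ ^ (1 - 2 * H)) =
        κ⁻¹ * ((1 - cos (ξ * ε)) * ξ ^ (-1 - 2 * H)) := by
    intro ξ hξ
    have hk : -(κ * ξ ^ 2) < 0 := neg_neg_of_pos (by positivity)
    rw [integral_mul_const, integral_exp_mul_Ioi hk, mul_zero, exp_zero, neg_div_neg_eq,
      show 1 - 2 * H = (-1 - 2 * H) + 2 by ring, rpow_add hξ, rpow_two]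
    field_simp
  have key := integral_Ioi_swap_of_nonneg
    (f := fun s ξ => exp (-(κ * ξ ^ 2) * s) * ((1 - cos (ξ * ε)) * ξ ^ (1 - 2 * H)))
    (by fun_prop)
    (fun s _ ξ hξ => mul_nonneg (exp_pos _).le
      (mul_nonneg (sub_nonneg.2 (cos_le_one _)) (rpow_nonneg (le_of_lt hξ) _)))
    (fun ξ hξ => (exp_neg_integrableOn_Ioi 0 (by positivity)).mul_const _)
    hinner
    (by rw [integral_const_mul, integral_one_sub_cos_mul_mul_rpow_Ioi h0 h1 hε, hG'])
    (by positivity)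
  simp only [hfold, hexp]
  have h3 : 1 - 2 * H ≠ 0 := by linarith
  rw [mul_comm π H] at hs key
  rw [integral_const_mul, key]
  field_simp
  ring
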